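/- Caccioppoli-type decay estimate for the heat operator: let U be a smooth function on a parabolic ball B(x,L) with ‖(∂ₜ-Δ)U‖_{B(x,L)} ≤ g. Write U = u_> + u_< where u_> solves (∂ₜ-Δ)u_> = 1_{B(x,L)}(∂ₜ-Δ)U with Dirichlet boundary conditions and u_< is caloric on B(x,L). Then for every R ≤ L/2: inf over affine functions l of ‖U - l‖_{B(x,R)} ≤ c( (R²/L²) · inf over affine l of ‖U - l‖_{B(x,L)} + L² g ), for a universal constant c. -/

import Mathlib

open MeasureTheory Finset Set

noncomputable section

/-- Space-time `ℝ × ℝ³`. -/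
abbrev SpTime := ℝ × (Fin 3 → ℝ)

/-- The parabolic metric `d((t,x),(s,y)) = max(√|t-s|, |x-y|_∞)`. -/
def pd (z w : SpTime) : ℝ := max (Real.sqrt |z.1 - w.1|) ‖z.2 - w.2‖

/-- Parabolic ball of radius `R` centred at `z`. -/
def pball (z : SpTime) (R : ℝ) : Set SpTime := {w | pd z w < R}

/-- Partial derivative in time. -/
def pderivT (f : SpTime → ℝ) (z : SpTime) : ℝ := deriv (fun s => f (s, z.2)) z.1

/-- Partial derivative in the `i`-th spatial direction. -/
def pderivX (f : SpTime → ℝ) (i : Fin 3) (z : SpTime) : ℝ :=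
  deriv (fun s => f (z.1, Function.update z.2 i s)) (z.2 i)

/-- Second partial derivative in the `i`-th spatial direction. -/
def pderivXX (f : SpTime → ℝ) (i : Fin 3) (z : SpTime) : ℝ :=
  deriv (fun s => pderivX f i (z.1, Function.update z.2 i s)) (z.2 i)

/-- Spatial Laplacian. -/
def plap (f : SpTime → ℝ) (z : SpTime) : ℝ := ∑ i, pderivXX f i z

/-- The heat operator `∂ₜ - Δ`. -/
def heatOp (f : SpTime → ℝ) (z : SpTime) : ℝ := pderivT f z - plap f z

/-- Parabolic rescaling of a kernel: `Φ_T(t,x) = T⁻⁵ Φ(t/T², x/T)`. -/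
def scaleK (Φ : SpTime → ℝ) (T : ℝ) (z : SpTime) : ℝ :=
  (T ^ 5)⁻¹ * Φ (z.1 / T ^ 2, fun i => z.2 i / T)

/-- Space-time convolution. -/
def convK (f g : SpTime → ℝ) (z : SpTime) : ℝ := ∫ w, f (z - w) * g w

/-- `PsiAux Φ T n = Ψ_{T,n+1} = Φ_{T/2} * ⋯ * Φ_{T 2^{-(n+1)}}`. -/
def PsiAux (Φ : SpTime → ℝ) (T : ℝ) : ℕ → SpTime → ℝ
  | 0 => scaleK Φ (T / 2)
  | n + 1 => convK (PsiAux Φ T n) (scaleK Φ (T / 2 ^ (n + 2)))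

/-- `Ψ_{T,n} = Φ_{T 2^{-1}} * ⋯ * Φ_{T 2^{-n}}` (for `n ≥ 1`). -/
def PsiN (Φ : SpTime → ℝ) (T : ℝ) (n : ℕ) : SpTime → ℝ := PsiAux Φ T (n - 1)

/-- Backward parabolic ball. -/
def pballB (z : SpTime) (R : ℝ) : Set SpTime := {w | pd z w < R ∧ w.1 < z.1}

/-- Parabolic boundary of a domain. -/
def pBoundary (D : Set SpTime) : Set SpTime :=
  {z | z ∈ closure D ∧ ∀ r, 0 < r → ¬ pballB z r ⊆ closure D}

/-- `D_d`: the points of `D` at parabolic distance at least `d` from the parabolic boundary. -/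
def shrink (D : Set SpTime) (d : ℝ) : Set SpTime := {z ∈ D | ∀ w ∈ pBoundary D, d ≤ pd z w}

/-- The parabolic box `P_R = (R²,1) × {|x|_∞ < 1-R}`. -/
def PRset (R : ℝ) : Set SpTime := Set.Ioo (R ^ 2) 1 ×ˢ {x : Fin 3 → ℝ | ‖x‖ < 1 - R}

/-- `W` is continuous at `z`, has the derivatives entering the heat operator there, and
`(∂ₜ - Δ) W = q` at `z`. -/
def HasHeatAt (W : SpTime → ℝ) (q : ℝ) (z : SpTime) : Prop :=
  ContinuousAt W z ∧ ∃ (a : ℝ) (d : Fin 3 → ℝ → ℝ) (e : Fin 3 → ℝ),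
    HasDerivAt (fun s => W (s, z.2)) a z.1 ∧
    (∀ i, ∀ᶠ s in nhds (z.2 i),
      HasDerivAt (fun s => W (z.1, Function.update z.2 i s)) (d i s) s) ∧
    (∀ i, HasDerivAt (d i) (e i) (z.2 i)) ∧ q = a - ∑ i, e i

lemma HasHeatAt.sub {V W : SpTime → ℝ} {q r : ℝ} {z : SpTime}
    (hV : HasHeatAt V q z) (hW : HasHeatAt W r z) :
    HasHeatAt (fun w => V w - W w) (q - r) z := by
  obtain ⟨hc, a, d, e, h1, h2, h3, rfl⟩ := hV
  obtain ⟨hc', a', d', e', h1', h2', h3', rfl⟩ := hW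
  refine ⟨hc.sub hc', a - a', fun i s => d i s - d' i s, fun i => e i - e' i, h1.sub h1',
    fun i => ?_, fun i => (h3 i).sub (h3' i), ?_⟩
  · filter_upwards [h2 i, h2' i] with s hs hs' using hs.sub hs'
  · rw [Finset.sum_sub_distrib]; ring

lemma HasHeatAt.neg {V : SpTime → ℝ} {q : ℝ} {z : SpTime} (hV : HasHeatAt V q z) :
    HasHeatAt (fun w => -V w) (-q) z := by
  obtain ⟨hc, a, d, e, h1, h2, h3, rfl⟩ := hV
  refine ⟨hc.neg, -a, fun i s => -d i s, fun i => -e i, h1.neg,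
    fun i => ?_, fun i => (h3 i).neg, ?_⟩
  · filter_upwards [h2 i] with s hs using hs.neg
  · rw [Finset.sum_neg_distrib]; ring

/-- The space-time affine map `(t, x) ↦ (a t + b, (σᵢ xᵢ + yᵢ)ᵢ)`. -/
def affMap (a b : ℝ) (σ y : Fin 3 → ℝ) (z : SpTime) : SpTime :=
  (a * z.1 + b, fun i => σ i * z.2 i + y i)

lemma affMap_update (σ y v : Fin 3 → ℝ) (i : Fin 3) (s : ℝ) :
    (fun k => σ k * Function.update v i s k + y k) =
      Function.update (fun k => σ k * v k + y k) i (σ i * s + y i) := by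
  ext k
  by_cases h : k = i
  · subst h; simp
  · simp [h]

/-- The heat operator is covariant under parabolic dilations, translations and reflections. -/
lemma HasHeatAt.comp_affMap {V : SpTime → ℝ} {q a b : ℝ} {σ y : Fin 3 → ℝ} {z : SpTime}
    (hσ : ∀ i, σ i ^ 2 = a) (hV : HasHeatAt V q (affMap a b σ y z)) :
    HasHeatAt (fun w => V (affMap a b σ y w)) (a * q) z := by
  obtain ⟨hc, a', d, e, h1, h2, h3, rfl⟩ := hV
  have hlin : ∀ (m n s : ℝ), HasDerivAt (fun s : ℝ => m * s + n) m s := fun m n s => by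
    simpa using ((hasDerivAt_id s).const_mul m).add_const n
  refine ⟨ContinuousAt.comp (g := V) hc ?_, a' * a, fun i s => d i (σ i * s + y i) * σ i,
    fun i => e i * σ i * σ i, ?_, fun i => ?_, fun i => ?_, ?_⟩
  · unfold affMap; fun_prop
  · exact HasDerivAt.comp z.1 h1 (hlin a b z.1)
  · have ht : Filter.Tendsto (fun s : ℝ => σ i * s + y i) (nhds (z.2 i))
        (nhds (σ i * z.2 i + y i)) := (hlin _ _ _).continuousAt
    filter_upwards [ht.eventually (h2 i)] with s hs
    have := HasDerivAt.comp s hs (hlin (σ i) (y i) s)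
    simpa only [affMap, affMap_update, Function.comp_def] using this
  · exact (HasDerivAt.comp (z.2 i) (h3 i) (hlin (σ i) (y i) (z.2 i))).mul_const _
  · rw [mul_sub, Finset.mul_sum, mul_comm]
    congr 1
    exact Finset.sum_congr rfl fun i _ => by rw [← hσ i]; ring

/-- Heat operator of a polynomial that is linear in time and a sum of quadratics in space. -/
lemma hasHeatAt_quadratic (α t₀ k : ℝ) (β γ x₀ : Fin 3 → ℝ) (z : SpTime) :
    HasHeatAt (fun w => α * (w.1 - t₀) +
      ∑ i, (β i * (w.2 i - x₀ i) + γ i * (w.2 i - x₀ i) ^ 2) + k) (α - ∑ i, 2 * γ i) z := by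
  have hl : ∀ (m n s : ℝ), HasDerivAt (fun s : ℝ => m * (s - n)) m s := fun m n s => by
    simpa using ((hasDerivAt_id s).sub_const n).const_mul m
  refine ⟨by fun_prop, α, fun i s => β i + 2 * γ i * (s - x₀ i), fun i => 2 * γ i,
    ?_, fun i => ?_, fun i => ?_, rfl⟩
  · exact ((hl α t₀ z.1).add_const
      (∑ i, (β i * (z.2 i - x₀ i) + γ i * (z.2 i - x₀ i) ^ 2))).add_const k
  · refine Filter.Eventually.of_forall fun s => ?_
    have h : ∀ j ∈ Finset.univ, HasDerivAt (fun s => β j * (Function.update z.2 i s j - x₀ j) +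
        γ j * (Function.update z.2 i s j - x₀ j) ^ 2)
        (if j = i then β i + 2 * γ i * (s - x₀ i) else 0) s := by
      intro j _
      by_cases hj : j = i
      · subst hj
        simp only [Function.update_self, if_true]
        refine ((hl (β j) (x₀ j) s).add
          ((((hasDerivAt_id s).sub_const (x₀ j)).pow 2).const_mul (γ j))).congr_deriv ?_
        simp only [id]; push_cast; ring
      · simpa [hj] using hasDerivAt_const s _
    have := ((HasDerivAt.fun_sum h).const_add (α * (z.1 - t₀))).add_const k
    simpa using this
  · exact (hl (2 * γ i) (x₀ i) (z.2 i)).const_add (β i)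

lemma HasDerivAt.nonpos_of_le_right {f : ℝ → ℝ} {d r : ℝ} (hr : 0 < r) (hf : HasDerivAt f d 0)
    (h : ∀ s ∈ Set.Icc 0 r, f s ≤ f 0) : d ≤ 0 := by
  have ht := (hasDerivAt_iff_tendsto_slope.1 hf).mono_left
    (nhdsWithin_mono 0 (fun s (hs : s ∈ Set.Ioi (0 : ℝ)) => ne_of_gt hs))
  refine le_of_tendsto ht ?_
  filter_upwards [Ioo_mem_nhdsGT hr] with s hs
  rw [slope_def_field]
  exact div_nonpos_of_nonpos_of_nonneg (sub_nonpos.2 (h s ⟨hs.1.le, hs.2.le⟩)) (by linarith [hs.1])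

lemma second_deriv_nonpos_of_isLocalMax {f f' : ℝ → ℝ} {e s : ℝ} (hm : IsLocalMax f s)
    (h1 : ∀ᶠ u in nhds s, HasDerivAt f (f' u) u) (h2 : HasDerivAt f' e s) : e ≤ 0 := by
  by_contra! he
  have hd : deriv f =ᶠ[nhds s] f' := h1.mono fun u hu => hu.deriv
  have h0 : deriv f s = 0 := hm.deriv_eq_zero
  have hdd : deriv (deriv f) s = e := by rw [hd.deriv_eq, h2.deriv]
  have hmin : IsLocalMin f s :=
    isLocalMin_of_deriv_deriv_pos (by rw [hdd]; exact he) h0 h1.self_of_nhds.continuousAt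
  have hconst : f =ᶠ[nhds s] fun _ => f s := by
    filter_upwards [hm, hmin] with u hu hu' using le_antisymm hu hu'
  have hd0 : deriv f =ᶠ[nhds s] fun _ => 0 := by
    filter_upwards [hconst.eventuallyEq_nhds] with u hu
    rw [hu.deriv_eq]; simp
  rw [hd0.deriv_eq] at hdd
  simp at hdd
  linarith

/-- Weak maximum principle for the heat operator on a space-time box. -/
lemma heat_maximum_principle {W : SpTime → ℝ} {T₀ T₁ : ℝ} {l u : Fin 3 → ℝ}
    (hc : ContinuousOn W (Set.Icc T₀ T₁ ×ˢ Set.Icc l u))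
    (hW : ∀ z ∈ Set.Icc T₀ T₁ ×ˢ Set.Icc l u, W z ≤ 0 ∨
      (T₀ < z.1 ∧ (∀ i, l i < z.2 i ∧ z.2 i < u i) ∧ ∃ q < 0, HasHeatAt W q z))
    {z : SpTime} (hz : z ∈ Set.Icc T₀ T₁ ×ˢ Set.Icc l u) : W z ≤ 0 := by
  obtain ⟨m, hm, hmax⟩ := (isCompact_Icc.prod isCompact_Icc).exists_isMaxOn ⟨z, hz⟩ hc
  refine (hmax hz).trans ?_
  obtain h | ⟨hT, hi, q, hq, -, a, d, e, h1, h2, h3, rfl⟩ := hW m hm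
  · exact h
  have ha : 0 ≤ a := by
    have hd : HasDerivAt (fun s : ℝ => W (m.1 - s, m.2)) (-a) 0 := by
      have hs : HasDerivAt (fun s : ℝ => m.1 - s) (-1) 0 := by
        simpa using (hasDerivAt_id (0 : ℝ)).const_sub m.1
      have h1' : HasDerivAt (fun s => W (s, m.2)) a (m.1 - 0) := by simpa using h1
      simpa [Function.comp_def] using HasDerivAt.comp (0 : ℝ) h1' hs
    have := hd.nonpos_of_le_right (sub_pos.2 hT) fun s hs => by
      have hmem : ((m.1 - s, m.2) : SpTime) ∈ Set.Icc T₀ T₁ ×ˢ Set.Icc l u :=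
        ⟨⟨by linarith [hs.2], by linarith [hs.1, hm.1.2]⟩, hm.2⟩
      simpa using hmax hmem
    linarith
  have he : ∀ i, e i ≤ 0 := fun i => by
    refine second_deriv_nonpos_of_isLocalMax ?_ (h2 i) (h3 i)
    filter_upwards [Icc_mem_nhds (hi i).1 (hi i).2] with s hs
    have hmem : ((m.1, Function.update m.2 i s) : SpTime) ∈ Set.Icc T₀ T₁ ×ˢ Set.Icc l u := by
      refine ⟨hm.1, fun k => ?_, fun k => ?_⟩ <;> by_cases hk : k = i
      · subst hk; simpa using hs.1
      · simpa [hk] using hm.2.1 k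
      · subst hk; simpa using hs.2
      · simpa [hk] using hm.2.2 k
    simpa using hmax hmem
  have := Finset.sum_nonpos fun i (_ : i ∈ Finset.univ) => he i
  linarith

/-- One-sided interior gradient estimate, by comparing `V` with its reflection. -/
lemma partial_deriv_le {V : SpTime → ℝ} {t₀ r M G p : ℝ} {x₀ : Fin 3 → ℝ} (hr : 0 < r)
    (hM : 0 < M) (hG : 0 ≤ G) (j : Fin 3)
    (hb : ∀ z : SpTime, z.1 ∈ Set.Icc (t₀ - r ^ 2) t₀ → (∀ i, |z.2 i - x₀ i| ≤ r) → |V z| ≤ M)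
    (hH : ∀ z : SpTime, z.1 ∈ Set.Icc (t₀ - r ^ 2) t₀ → (∀ i, |z.2 i - x₀ i| ≤ r) →
      ∃ q, |q| ≤ G ∧ HasHeatAt V q z)
    (hp : HasDerivAt (fun s => V (t₀, Function.update x₀ j s)) p (x₀ j)) :
    p ≤ 6 * M / r + r * G := by
  set A := 2 * M / r ^ 2 with hA
  have hA0 : 0 < A := by positivity
  have hAr : A * r ^ 2 = 2 * M := by rw [hA]; field_simp
  set B := 3 * A + G with hB
  have hBr : 2 * M ≤ B * r ^ 2 := by rw [← hAr]; gcongr; linarith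
  set σ : Fin 3 → ℝ := fun i => if i = j then -1 else 1 with hσ
  set y : Fin 3 → ℝ := fun i => if i = j then 2 * x₀ j else 0 with hy
  set β : Fin 3 → ℝ := fun i => if i = j then 2 * r * B else 0 with hβ
  set γ : Fin 3 → ℝ := fun i => if i = j then -B else A with hγ
  set ρ : SpTime → SpTime := affMap 1 0 σ y with hρ
  set P : SpTime → ℝ := fun w => (-A) * (w.1 - t₀) +
      ∑ i, (β i * (w.2 i - x₀ i) + γ i * (w.2 i - x₀ i) ^ 2) + 0 with hP
  set W : SpTime → ℝ := fun w => (V w - V (ρ w)) - P w with hWdef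
  set l : Fin 3 → ℝ := fun i => if i = j then x₀ i else x₀ i - r with hl
  set u : Fin 3 → ℝ := fun i => x₀ i + r with hu
  have hσ2 : ∀ i, σ i ^ 2 = 1 := fun i => by by_cases h : i = j <;> simp [hσ, h]
  have hγs : ∑ i, 2 * γ i = 4 * A - 2 * B := by
    fin_cases j <;> simp [hγ, Fin.sum_univ_three] <;> ring
  have hbox : ∀ z : SpTime, z ∈ Set.Icc (t₀ - r ^ 2) t₀ ×ˢ Set.Icc l u →
      (∀ i, |z.2 i - x₀ i| ≤ r) ∧ (∀ i, |(ρ z).2 i - x₀ i| ≤ r) ∧ 0 ≤ z.2 j - x₀ j := by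
    intro z hz
    have h1 : ∀ i, |z.2 i - x₀ i| ≤ r := fun i => by
      have hl' := hz.2.1 i
      have hu' := hz.2.2 i
      simp only [hl, hu] at hl' hu'
      rw [abs_le]
      split_ifs at hl' <;> constructor <;> linarith
    refine ⟨h1, fun i => ?_, ?_⟩
    · by_cases h : i = j
      · subst h
        have : (ρ z).2 i - x₀ i = -(z.2 i - x₀ i) := by simp [hρ, affMap, hσ, hy]; ring
        rw [this, abs_neg]; exact h1 i
      · simpa [hρ, affMap, hσ, hy, h] using h1 i
    · simpa [hl] using hz.2.1 j
  have hρ1 : ∀ z, (ρ z).1 = z.1 := fun z => by simp [hρ, affMap]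
  have hheat : ∀ z : SpTime, z ∈ Set.Icc (t₀ - r ^ 2) t₀ ×ˢ Set.Icc l u →
      ∃ q < 0, HasHeatAt W q z := by
    intro z hz
    obtain ⟨h1, h2, -⟩ := hbox z hz
    obtain ⟨q, hq, hq'⟩ := hH z hz.1 h1
    obtain ⟨q₂, hq₂, hq₂'⟩ := hH (ρ z) (by rw [hρ1]; exact hz.1) h2
    refine ⟨_, ?_, (hq'.sub (hq₂'.comp_affMap hσ2)).sub
      (hasHeatAt_quadratic (-A) t₀ 0 β γ x₀ z)⟩
    rw [hγs]
    have := (abs_le.1 hq).2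
    have := (abs_le.1 hq₂).1
    linarith
  have key : ∀ z ∈ Set.Icc (t₀ - r ^ 2) t₀ ×ˢ Set.Icc l u, W z ≤ 0 := by
    refine fun z hz => heat_maximum_principle
      (fun z hz => (hheat z hz).choose_spec.2.1.continuousWithinAt) (fun z hz => ?_) hz
    obtain ⟨h1, h2, h3⟩ := hbox z hz
    by_cases hint : t₀ - r ^ 2 < z.1 ∧ ∀ i, l i < z.2 i ∧ z.2 i < u i
    · exact Or.inr ⟨hint.1, hint.2, hheat z hz⟩
    left
    have hterm : ∀ i, 0 ≤ β i * (z.2 i - x₀ i) + γ i * (z.2 i - x₀ i) ^ 2 := fun i => by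
      by_cases h : i = j
      · subst h
        simp only [hβ, hγ, if_true]
        have : 0 ≤ B * (z.2 i - x₀ i) * (2 * r - (z.2 i - x₀ i)) :=
          mul_nonneg (by positivity) (by linarith [(abs_le.1 (h1 i)).2])
        linarith
      · simp only [hβ, hγ, if_neg h, zero_mul, zero_add]
        positivity
    have htime : 0 ≤ (-A) * (z.1 - t₀) := by nlinarith [hz.1.2]
    have hsum := fun i => Finset.single_le_sum (fun k _ => hterm k) (Finset.mem_univ i)
    have hs0 := Finset.sum_nonneg fun k (_ : k ∈ Finset.univ) => hterm k
    have hV : V z - V (ρ z) ≤ 2 * M := by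
      have := (abs_le.1 (hb z hz.1 h1)).2
      have := (abs_le.1 (hb (ρ z) (by rw [hρ1]; exact hz.1) h2)).1
      linarith
    simp only [hWdef, hP]
    by_cases ht : t₀ - r ^ 2 < z.1
    swap
    · have : z.1 - t₀ = - r ^ 2 := by linarith [hz.1.1]
      rw [this]; nlinarith
    obtain ⟨i, hi⟩ : ∃ i, ¬ (l i < z.2 i ∧ z.2 i < u i) := by
      by_contra! h
      exact hint ⟨ht, h⟩
    have hi1 := hz.2.1 i
    have hi2 := hz.2.2 i
    have hsi := hsum i
    by_cases h : i = j
    · subst h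
      by_cases hlt : l i < z.2 i
      · have : z.2 i - x₀ i = r := by
          have : ¬ z.2 i < u i := fun h => hi ⟨hlt, h⟩
          simp only [hu] at this hi2
          linarith
        simp only [this, hβ, hγ, if_true] at hsi
        simp only [hβ, hγ] at *
        nlinarith
      · have hzi : z.2 i = x₀ i := by
          simp only [hl, if_true] at hlt hi1
          linarith
        have : ρ z = z := by
          refine Prod.ext (hρ1 z) (funext fun k => ?_)
          by_cases hk : k = i
          · subst hk; simp [hρ, affMap, hσ, hy, hzi]; ring
          · simp [hρ, affMap, hσ, hy, hk]
        rw [this]; linarith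
    · have : (z.2 i - x₀ i) ^ 2 = r ^ 2 := by
        simp only [hl, hu, if_neg h] at hi hi1 hi2
        by_cases hlt : x₀ i - r < z.2 i
        · have : z.2 i = x₀ i + r := by
            have : ¬ z.2 i < x₀ i + r := fun h => hi ⟨hlt, h⟩
            linarith
          rw [this]; ring
        · have : z.2 i = x₀ i - r := by linarith
          rw [this]; ring
      simp only [this, hβ, hγ, if_neg h] at hsi
      simp only [hβ, hγ] at *
      linarith
  have hder : HasDerivAt (fun h : ℝ => V (t₀, Function.update x₀ j (x₀ j + h)) -
      V (t₀, Function.update x₀ j (x₀ j - h)) - 2 * r * B * h) (p + p - 2 * r * B) 0 := by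
    have e1 : HasDerivAt (fun h : ℝ => x₀ j + h) 1 0 := by
      simpa using (hasDerivAt_id (0 : ℝ)).const_add (x₀ j)
    have e2 : HasDerivAt (fun h : ℝ => x₀ j - h) (-1) 0 := by
      simpa using (hasDerivAt_id (0 : ℝ)).const_sub (x₀ j)
    have f1 := HasDerivAt.comp (0 : ℝ) (by simpa using hp) e1
    have f2 := HasDerivAt.comp (0 : ℝ) (by simpa using hp) e2
    simpa [Function.comp_def] using (f1.fun_sub f2).fun_sub ((hasDerivAt_id (0 : ℝ)).const_mul (2 * r * B))
  have hfin := hder.nonpos_of_le_right hr fun h hh => by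
    have hmem : ((t₀, Function.update x₀ j (x₀ j + h)) : SpTime) ∈
        Set.Icc (t₀ - r ^ 2) t₀ ×ˢ Set.Icc l u := by
      refine ⟨⟨by simp; positivity, le_rfl⟩, fun k => ?_, fun k => ?_⟩ <;> by_cases hk : k = j
      · subst hk; simpa [hl] using hh.1
      · simp [hl, hk, hr.le]
      · subst hk; simpa [hu] using hh.2
      · simp [hu, hk, hr.le]
    have hk := key _ hmem
    have hρz : ρ (t₀, Function.update x₀ j (x₀ j + h)) =
        (t₀, Function.update x₀ j (x₀ j - h)) := by
      refine Prod.ext (hρ1 _) (funext fun k => ?_)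
      by_cases hk : k = j
      · subst hk; simp [hρ, affMap, hσ, hy]; ring
      · simp [hρ, affMap, hσ, hy, hk]
    have hPz : P (t₀, Function.update x₀ j (x₀ j + h)) = 2 * r * B * h - B * h ^ 2 := by
      simp only [hP]
      rw [Finset.sum_eq_single j]
      · simp [hβ, hγ]; ring
      · intro i _ hi
        simp [hi]
      · simp
    simp only [hWdef, hρz, hPz] at hk
    simp
    nlinarith [mul_nonneg (show 0 ≤ B by positivity) (sq_nonneg h)]
  have : r * B = 6 * M / r + r * G := by
    rw [hB, hA]; field_simp; ring
  linarith

/-- Interior gradient estimate for the inhomogeneous heat equation. -/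
lemma abs_partial_deriv_le {V : SpTime → ℝ} {t₀ r M G p : ℝ} {x₀ : Fin 3 → ℝ} (hr : 0 < r)
    (hM : 0 < M) (hG : 0 ≤ G) (j : Fin 3)
    (hb : ∀ z : SpTime, z.1 ∈ Set.Icc (t₀ - r ^ 2) t₀ → (∀ i, |z.2 i - x₀ i| ≤ r) → |V z| ≤ M)
    (hH : ∀ z : SpTime, z.1 ∈ Set.Icc (t₀ - r ^ 2) t₀ → (∀ i, |z.2 i - x₀ i| ≤ r) →
      ∃ q, |q| ≤ G ∧ HasHeatAt V q z)
    (hp : HasDerivAt (fun s => V (t₀, Function.update x₀ j s)) p (x₀ j)) :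
    |p| ≤ 6 * M / r + r * G := by
  have h1 := partial_deriv_le hr hM hG j hb hH hp
  have h2 := partial_deriv_le (V := fun z => -V z) hr hM hG j
    (fun z hz hz' => by rw [abs_neg]; exact hb z hz hz')
    (fun z hz hz' => by
      obtain ⟨q, hq, hq'⟩ := hH z hz hz'
      exact ⟨-q, by rwa [abs_neg], hq'.neg⟩) hp.neg
  exact abs_le.2 ⟨by linarith, h1⟩

/-- A function on `ℝ³` whose partial derivatives are bounded by `N` on a box is `N`-Lipschitz
between opposite corners, in the `ℓ¹` distance. -/
lemma abs_sub_le_of_partial_deriv {f : (Fin 3 → ℝ) → ℝ} {N : ℝ} {x y : Fin 3 → ℝ}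
    (h : ∀ w : Fin 3 → ℝ, (∀ i, w i ∈ Set.uIcc (x i) (y i)) →
      ∀ i, ∃ p, |p| ≤ N ∧ HasDerivAt (fun s => f (Function.update w i s)) p (w i)) :
    |f y - f x| ≤ N * ∑ i, |y i - x i| := by
  have step : ∀ (w : Fin 3 → ℝ) (i : Fin 3), (∀ k, w k ∈ Set.uIcc (x k) (y k)) → w i = x i →
      |f (Function.update w i (y i)) - f w| ≤ N * |y i - x i| := by
    intro w i hw hi
    have hw' : ∀ s ∈ Set.uIcc (x i) (y i), ∀ k,
        Function.update w i s k ∈ Set.uIcc (x k) (y k) := by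
      intro s hs k
      by_cases hk : k = i
      · subst hk; simpa using hs
      · simpa [hk] using hw k
    have hder : ∀ s ∈ Set.uIcc (x i) (y i), ∃ p, |p| ≤ N ∧
        HasDerivAt (fun s => f (Function.update w i s)) p s := by
      intro s hs
      simpa using h _ (hw' s hs) i
    have := (convex_uIcc (x i) (y i)).norm_image_sub_le_of_norm_deriv_le
      (f := fun s => f (Function.update w i s)) (C := N)
      (fun s hs => (hder s hs).choose_spec.2.differentiableAt)
      (fun s hs => by
        rw [(hder s hs).choose_spec.2.deriv]; exact (hder s hs).choose_spec.1)
      Set.left_mem_uIcc Set.right_mem_uIcc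
    simpa [← hi] using this
  have s0 := step x 0 (fun k => Set.left_mem_uIcc) rfl
  have s1 := step (Function.update x 0 (y 0)) 1
    (fun k => by fin_cases k <;> simp) (by simp)
  have s2 := step (Function.update (Function.update x 0 (y 0)) 1 (y 1)) 2
    (fun k => by fin_cases k <;> simp) (by simp)
  have hy : Function.update (Function.update (Function.update x 0 (y 0)) 1 (y 1)) 2 (y 2) = y := by
    ext k; fin_cases k <;> simp
  rw [hy] at s2
  rw [Fin.sum_univ_three]
  rw [abs_le] at *
  constructor <;> linarith

lemma HasHeatAt.exists_hasDerivAt {V : SpTime → ℝ} {q : ℝ} {z : SpTime} (h : HasHeatAt V q z)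
    (i : Fin 3) : ∃ p, HasDerivAt (fun s => V (z.1, Function.update z.2 i s)) p (z.2 i) := by
  obtain ⟨-, a, d, e, -, h2, -⟩ := h
  exact ⟨_, (h2 i).self_of_nhds⟩

/-- `V` is bounded by `K` and has heat operator bounded by `G` on the unit parabolic cylinder. -/
def HeatBounded (V : SpTime → ℝ) (K G : ℝ) : Prop :=
  ∀ z : SpTime, |z.1| < 1 → (∀ i, |z.2 i| < 1) → |V z| ≤ K ∧ ∃ q, |q| ≤ G ∧ HasHeatAt V q z

lemma HeatBounded.neg {V : SpTime → ℝ} {K G : ℝ} (hV : HeatBounded V K G) :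
    HeatBounded (fun z => -V z) K G := fun z h1 h2 => by
  obtain ⟨hb, q, hq, hq'⟩ := hV z h1 h2
  exact ⟨by rwa [abs_neg], -q, by rwa [abs_neg], hq'.neg⟩

section
variable {V : SpTime → ℝ} {K G : ℝ}

lemma HeatBounded.abs_partial_le (hK : 0 < K) (hG : 0 ≤ G) (hV : HeatBounded V K G)
    {t : ℝ} {x : Fin 3 → ℝ} (ht : |t| ≤ 1 / 2) (hx : ∀ i, |x i| ≤ 7 / 8) {i : Fin 3} {p : ℝ}
    (hp : HasDerivAt (fun s => V (t, Function.update x i s)) p (x i)) :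
    |p| ≤ 96 * (K + G) := by
  have hdom : ∀ z : SpTime, z.1 ∈ Set.Icc (t - (1 / 16 : ℝ) ^ 2) t →
      (∀ i, |z.2 i - x i| ≤ 1 / 16) → |V z| ≤ K ∧ ∃ q, |q| ≤ G ∧ HasHeatAt V q z := by
    refine fun z hz hz' => hV z ?_ fun i => ?_
    · have := abs_le.1 ht
      have := hz.1
      have := hz.2
      rw [abs_lt]; constructor <;> linarith
    · have := abs_le.1 (hx i)
      have := abs_le.1 (hz' i)
      rw [abs_lt]; constructor <;> linarith
  have := abs_partial_deriv_le (by norm_num) hK hG i (fun z hz hz' => (hdom z hz hz').1)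
    (fun z hz hz' => (hdom z hz hz').2) hp
  linarith

lemma HeatBounded.abs_sub_le (hK : 0 < K) (hG : 0 ≤ G) (hV : HeatBounded V K G)
    {t : ℝ} {x y : Fin 3 → ℝ} (ht : |t| ≤ 1 / 2) (hx : ∀ i, |x i| ≤ 7 / 8)
    (hy : ∀ i, |y i| ≤ 7 / 8) :
    |V (t, y) - V (t, x)| ≤ 96 * (K + G) * ∑ i, |y i - x i| := by
  refine abs_sub_le_of_partial_deriv (f := fun w => V (t, w)) fun w hw i => ?_
  have hw' : ∀ i, |w i| ≤ 7 / 8 := fun i =>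
    abs_le.2 ⟨(le_min (abs_le.1 (hx i)).1 (abs_le.1 (hy i)).1).trans (hw i).1,
      (hw i).2.trans (max_le (abs_le.1 (hx i)).2 (abs_le.1 (hy i)).2)⟩
  obtain ⟨-, q, -, hq⟩ := hV (t, w) (by simp only; linarith) fun i => (hw' i).trans_lt (by norm_num)
  obtain ⟨p, hp⟩ := hq.exists_hasDerivAt i
  exact ⟨p, hV.abs_partial_le hK hG ht hw' hp, hp⟩

lemma HeatBounded.abs_partial_sub_le (hK : 0 < K) (hG : 0 ≤ G) (hV : HeatBounded V K G)
    {t : ℝ} {x y : Fin 3 → ℝ} (ht : |t| ≤ 1 / 4) (hx : ∀ i, |x i| ≤ 3 / 4)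
    (hy : ∀ i, |y i| ≤ 3 / 4) {i : Fin 3} {p p' : ℝ}
    (hp : HasDerivAt (fun s => V (t, Function.update x i s)) p (x i))
    (hp' : HasDerivAt (fun s => V (t, Function.update y i s)) p' (y i)) :
    |p' - p| ≤ 4608 * (K + G) * ∑ i, |y i - x i| + G := by
  obtain rfl | hne := eq_or_ne x y
  · rw [hp'.unique hp]; simpa
  have hδ : 0 < ∑ i, |y i - x i| := by
    obtain ⟨k, hk⟩ := Function.ne_iff.1 hne
    exact Finset.sum_pos' (fun _ _ => abs_nonneg _)
      ⟨k, Finset.mem_univ k, abs_pos.2 (sub_ne_zero.2 hk.symm)⟩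
  have hd : HasDerivAt (fun s => V (affMap 1 0 1 (y - x) (t, Function.update x i s)) -
      V (t, Function.update x i s)) (p' - p) (x i) := by
    refine HasDerivAt.fun_sub ?_ hp
    have e : HasDerivAt (fun s : ℝ => s + (y i - x i)) 1 (x i) :=
      (hasDerivAt_id (x i)).add_const _
    have := HasDerivAt.comp (x i) (h₂ := fun s => V (t, Function.update y i s)) (h₂' := p')
      (by simpa using hp') e
    simp only [affMap, affMap_update]
    simpa [Function.comp_def] using this
  have hdom : ∀ z : SpTime, z.1 ∈ Set.Icc (t - (1 / 8 : ℝ) ^ 2) t →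
      (∀ i, |z.2 i - x i| ≤ 1 / 8) → |z.1| ≤ 1 / 2 ∧ (∀ i, |z.2 i| ≤ 7 / 8) ∧
        ∀ i, |z.2 i + (y i - x i)| ≤ 7 / 8 := by
    refine fun z hz hz' => ⟨?_, fun i => ?_, fun i => ?_⟩
    · have := abs_le.1 ht
      have := hz.1
      have := hz.2
      rw [abs_le]; constructor <;> linarith
    · have := abs_le.1 (hx i)
      have := abs_le.1 (hz' i)
      rw [abs_le]; constructor <;> linarith
    · have := abs_le.1 (hy i)
      have := abs_le.1 (hz' i)
      rw [abs_le]; constructor <;> linarith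
  have haff : ∀ z : SpTime, affMap 1 0 1 (y - x) z = (z.1, fun i => z.2 i + (y i - x i)) :=
    fun z => by simp [affMap]
  have := abs_partial_deriv_le (G := 2 * G) (M := 96 * (K + G) * ∑ i, |y i - x i|)
    (V := fun z => V (affMap 1 0 1 (y - x) z) - V z) (r := 1 / 8) (by norm_num)
    (by positivity) (by positivity) i
    (fun z hz hz' => by
      obtain ⟨h1, h2, h3⟩ := hdom z hz hz'
      simp only [haff]
      simpa using hV.abs_sub_le hK hG h1 h2 h3)
    (fun z hz hz' => by
      obtain ⟨h1, h2, h3⟩ := hdom z hz hz'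
      obtain ⟨-, q, hq, hq'⟩ := hV z (by linarith) (fun i => by linarith [h2 i])
      obtain ⟨-, q₂, hq₂, hq₂'⟩ := hV (affMap 1 0 1 (y - x) z) (by rw [haff]; simp only; linarith)
        (fun i => by rw [haff]; simp only; linarith [h3 i])
      refine ⟨_, ?_, (hq₂'.comp_affMap (by simp)).sub hq'⟩
      rw [abs_le] at *
      constructor <;> linarith) hd
  linarith

/-- First-order Taylor estimate in space. -/
lemma HeatBounded.abs_taylor_le (hK : 0 < K) (hG : 0 ≤ G) (hV : HeatBounded V K G)
    {t : ℝ} {x y p : Fin 3 → ℝ} (ht : |t| ≤ 1 / 4) (hx : ∀ i, |x i| ≤ 3 / 4)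
    (hy : ∀ i, |y i| ≤ 3 / 4)
    (hp : ∀ i, HasDerivAt (fun s => V (t, Function.update x i s)) (p i) (x i)) :
    |V (t, y) - V (t, x) - ∑ i, p i * (y i - x i)| ≤
      (4608 * (K + G) * ∑ i, |y i - x i| + G) * ∑ i, |y i - x i| := by
  have := abs_sub_le_of_partial_deriv (x := x) (y := y)
    (N := 4608 * (K + G) * ∑ i, |y i - x i| + G)
    (f := fun w => V (t, w) - ∑ i, p i * (w i - x i)) fun w hw i => by
      have hw' : ∀ i, |w i| ≤ 3 / 4 := fun i =>
        abs_le.2 ⟨(le_min (abs_le.1 (hx i)).1 (abs_le.1 (hy i)).1).trans (hw i).1,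
          (hw i).2.trans (max_le (abs_le.1 (hx i)).2 (abs_le.1 (hy i)).2)⟩
      obtain ⟨-, q, -, hq⟩ := hV (t, w) (by simp only; linarith)
        fun i => (hw' i).trans_lt (by norm_num)
      obtain ⟨p', hp'⟩ := hq.exists_hasDerivAt i
      refine ⟨p' - p i, ?_, hp'.fun_sub ?_⟩
      · refine (hV.abs_partial_sub_le hK hG ht hx hw' (hp i) hp').trans ?_
        have hle : ∑ i, |w i - x i| ≤ ∑ i, |y i - x i| :=
          Finset.sum_le_sum fun k _ => Set.abs_sub_left_of_mem_uIcc (hw k)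
        gcongr
      · have h : ∀ j ∈ Finset.univ, HasDerivAt
            (fun s => p j * (Function.update w i s j - x j)) (if j = i then p i else 0) (w i) := by
          intro j _
          by_cases hj : j = i
          · subst hj
            simpa using ((hasDerivAt_id (w j)).sub_const (x j)).const_mul (p j)
          · simpa [hj] using hasDerivAt_const (w i) (p j * (w j - x j))
        simpa using HasDerivAt.fun_sum h
  simpa [sub_right_comm] using this

lemma sq_sum_abs_le (v : Fin 3 → ℝ) : (∑ i, |v i|) ^ 2 ≤ 3 * ∑ i, v i ^ 2 := by
  have h := sq_sum_le_card_mul_sum_sq (s := Finset.univ) (f := fun i => |v i|)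
  simpa using h

lemma HeatBounded.abs_taylor_le_sq (hK : 0 < K) (hG : 0 ≤ G) (hV : HeatBounded V K G)
    {t : ℝ} {x y p : Fin 3 → ℝ} (ht : |t| ≤ 1 / 4) (hx : ∀ i, |x i| ≤ 3 / 4)
    (hy : ∀ i, |y i| ≤ 3 / 4) (hxy : ∀ i, |y i - x i| ≤ 1 / 2)
    (hp : ∀ i, HasDerivAt (fun s => V (t, Function.update x i s)) (p i) (x i)) :
    |V (t, y) - V (t, x) - ∑ i, p i * (y i - x i)| ≤
      13824 * K * ∑ i, (y i - x i) ^ 2 + 11000 * G := by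
  refine (hV.abs_taylor_le hK hG ht hx hy hp).trans ?_
  have h1 := sq_sum_abs_le (fun i => y i - x i)
  have h0 : 0 ≤ ∑ i, |y i - x i| := by positivity
  have h2 : ∑ i, |y i - x i| ≤ 3 / 2 := by
    rw [Fin.sum_univ_three]; linarith [hxy 0, hxy 1, hxy 2]
  set δ := ∑ i, |y i - x i|
  have h3 : δ ^ 2 ≤ 9 / 4 := by nlinarith
  nlinarith [mul_le_mul_of_nonneg_left h1 hK.le, mul_le_mul_of_nonneg_left h3 hG,
    mul_le_mul_of_nonneg_left h2 hG]

lemma HeatBounded.time_sub_le (hK : 0 < K) (hG : 0 ≤ G) (hV : HeatBounded V K G)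
    {s t : ℝ} {x : Fin 3 → ℝ} (hs : |s| ≤ 1 / 4) (ht : |t| ≤ 1 / 4) (hst : s ≤ t)
    (hx : ∀ i, |x i| ≤ 1 / 2) :
    V (t, x) - V (s, x) ≤ 300000 * (K * (t - s) + G) := by
  have hs' := abs_le.1 hs
  have ht' := abs_le.1 ht
  have hV0 := hV (s, x) (by simp only; linarith) fun i => (hx i).trans_lt (by norm_num)
  obtain ⟨-, q₀, -, hq₀⟩ := id hV0
  choose p hp using fun i => hq₀.exists_hasDerivAt i
  simp only at hp
  have hpb : ∀ i, |p i| ≤ 96 * (K + G) := fun i => hV.abs_partial_le hK hG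
    (hs.trans (by norm_num)) (fun i => (hx i).trans (by norm_num)) (hp i)
  set k := V (s, x) + 33000 * G
  set P : SpTime → ℝ := fun w => (198000 * K + G + K) * (w.1 - s) +
      ∑ i, (p i * (w.2 i - x i) + (33000 * K) * (w.2 i - x i) ^ 2) + k with hP
  set l : Fin 3 → ℝ := fun i => x i - 1 / 4 with hl
  set u : Fin 3 → ℝ := fun i => x i + 1 / 4 with hu
  have hdom : ∀ z : SpTime, z ∈ Set.Icc s t ×ˢ Set.Icc l u →
      |z.1| ≤ 1 / 4 ∧ (∀ i, |z.2 i - x i| ≤ 1 / 4) ∧ (∀ i, |z.2 i| ≤ 3 / 4) := by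
    intro z hz
    have h1 : ∀ i, |z.2 i - x i| ≤ 1 / 4 := fun i => by
      have hl' := hz.2.1 i
      have hu' := hz.2.2 i
      simp only [hl, hu] at hl' hu'
      rw [abs_le]; constructor <;> linarith
    refine ⟨abs_le.2 ⟨by linarith [hz.1.1], by linarith [hz.1.2]⟩, h1, fun i => ?_⟩
    have := abs_le.1 (h1 i)
    have := abs_le.1 (hx i)
    rw [abs_le]; constructor <;> linarith
  have hheat : ∀ z : SpTime, z ∈ Set.Icc s t ×ˢ Set.Icc l u →
      ∃ q < 0, HasHeatAt (fun w => V w - P w) q z := by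
    intro z hz
    obtain ⟨h1, -, h2⟩ := hdom z hz
    obtain ⟨-, q, hq, hq'⟩ := hV z (by linarith) (fun i => by linarith [h2 i])
    refine ⟨_, ?_, hq'.sub (hasHeatAt_quadratic _ s k p (fun _ => 33000 * K) x z)⟩
    have := (abs_le.1 hq).2
    simp only [Finset.sum_const, Finset.card_univ, Fintype.card_fin, nsmul_eq_mul]
    push_cast
    linarith
  have key : V (t, x) - P (t, x) ≤ 0 := by
    refine heat_maximum_principle (W := fun w => V w - P w) (T₀ := s) (T₁ := t) (l := l) (u := u)
      (fun z hz => (hheat z hz).choose_spec.2.1.continuousWithinAt) (fun z hz => ?_)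
      ⟨⟨hst, le_rfl⟩, fun i => by simp [hl], fun i => by simp [hu]⟩
    obtain ⟨h1, h2, h3⟩ := hdom z hz
    by_cases hint : s < z.1 ∧ ∀ i, l i < z.2 i ∧ z.2 i < u i
    · exact Or.inr ⟨hint.1, hint.2, hheat z hz⟩
    left
    simp only [hP, Finset.sum_add_distrib, ← Finset.mul_sum]
    have hsq : 0 ≤ ∑ i, (z.2 i - x i) ^ 2 := by positivity
    have htime : 0 ≤ (198000 * K + G + K) * (z.1 - s) :=
      mul_nonneg (by positivity) (by linarith [hz.1.1])
    by_cases hts : s < z.1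
    swap
    · have hz1 : z.1 = s := by linarith [hz.1.1]
      have hT := (abs_le.1 (hV.abs_taylor_le_sq hK hG hs
        (fun i => (hx i).trans (by norm_num)) h3 (fun i => (h2 i).trans (by norm_num)) hp)).2
      have hzz : ((s, z.2) : SpTime) = z := Prod.ext hz1.symm rfl
      rw [hzz] at hT
      have := mul_nonneg hK.le hsq
      linarith
    obtain ⟨i, hi⟩ : ∃ i, ¬ (l i < z.2 i ∧ z.2 i < u i) := by
      by_contra! h
      exact hint ⟨hts, h⟩
    have hi1 := hz.2.1 i
    have hi2 := hz.2.2 i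
    have hsqi : (z.2 i - x i) ^ 2 = 1 / 16 := by
      simp only [hl, hu] at hi hi1 hi2
      by_cases hlt : x i - 1 / 4 < z.2 i
      · have : z.2 i = x i + 1 / 4 := by
          have : ¬ z.2 i < x i + 1 / 4 := fun h => hi ⟨hlt, h⟩
          linarith
        rw [this]; ring
      · have : z.2 i = x i - 1 / 4 := by linarith
        rw [this]; ring
    have hsum : 1 / 16 ≤ ∑ i, (z.2 i - x i) ^ 2 := by
      rw [← hsqi]
      exact Finset.single_le_sum (f := fun i => (z.2 i - x i) ^ 2) (fun k _ => sq_nonneg _)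
        (Finset.mem_univ i)
    have hlin : ∀ i, -(24 * (K + G)) ≤ p i * (z.2 i - x i) := fun i => by
      have : |p i * (z.2 i - x i)| ≤ 96 * (K + G) * (1 / 4) := by
        rw [abs_mul]
        exact mul_le_mul (hpb i) (h2 i) (abs_nonneg _) (by positivity)
      linarith [(abs_le.1 this).1]
    have hlin3 : -(72 * (K + G)) ≤ ∑ i, p i * (z.2 i - x i) := by
      rw [Fin.sum_univ_three]; linarith [hlin 0, hlin 1, hlin 2]
    have hVz := (abs_le.1 (hV z (by linarith) (fun i => by linarith [h3 i])).1).2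
    have hVs := (abs_le.1 hV0.1).1
    have := mul_le_mul_of_nonneg_left hsum hK.le
    linarith
  simp only [hP, sub_self] at key
  simp at key
  nlinarith [mul_nonneg hG (sub_nonneg.2 hst), mul_nonneg hK.le (sub_nonneg.2 hst)]

lemma HeatBounded.abs_time_sub_le (hK : 0 < K) (hG : 0 ≤ G) (hV : HeatBounded V K G)
    {s t : ℝ} {x : Fin 3 → ℝ} (hs : |s| ≤ 1 / 4) (ht : |t| ≤ 1 / 4) (hx : ∀ i, |x i| ≤ 1 / 2) :
    |V (t, x) - V (s, x)| ≤ 300000 * (K * |t - s| + G) := by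
  wlog hst : s ≤ t generalizing s t
  · rw [abs_sub_comm, abs_sub_comm t]
    exact this ht hs (le_of_not_ge hst)
  have h1 := hV.time_sub_le hK hG hs ht hst hx
  have h2 := hV.neg.time_sub_le hK hG hs ht hst hx
  rw [abs_of_nonneg (sub_nonneg.2 hst), abs_le]
  constructor <;> linarith

/-- Excess decay on the unit cylinder. -/
lemma HeatBounded.exists_affine (hK : 0 < K) (hG : 0 ≤ G) (hV : HeatBounded V K G) {R : ℝ}
    (hR : R ≤ 1 / 2) : ∃ (p : Fin 3 → ℝ) (k : ℝ), ∀ z : SpTime, |z.1| < R ^ 2 →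
      (∀ i, |z.2 i| < R) →
      |V z - (∑ i, p i * z.2 i + k)| ≤ 400000 * (R ^ 2 * K + G) := by
  obtain ⟨-, q₀, -, hq₀⟩ := hV 0 (by simp) (by simp)
  choose p hp using fun i => hq₀.exists_hasDerivAt i
  refine ⟨p, V 0, fun z hz hz' => ?_⟩
  have hR0 : 0 < R := (abs_nonneg _).trans_lt (hz' 0)
  have hR2 : R ^ 2 ≤ 1 / 4 := by nlinarith
  have hz2 : ∀ i, |z.2 i| ≤ 1 / 2 := fun i => (hz' i).le.trans hR
  have h1 := hV.abs_time_sub_le hK hG (s := 0) (t := z.1) (x := z.2) (by simp)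
    (by linarith) hz2
  have h2 := hV.abs_taylor_le_sq hK hG (t := 0) (x := 0) (y := z.2) (by simp)
    (fun i => by simp; norm_num) (fun i => (hz2 i).trans (by norm_num)) (by simpa using hz2) hp
  have hsq : ∀ i, z.2 i ^ 2 ≤ R ^ 2 := fun i => sq_le_sq' (by linarith [(abs_lt.1 (hz' i)).1])
    (abs_lt.1 (hz' i)).2.le
  have hsum : ∑ i, z.2 i ^ 2 ≤ 3 * R ^ 2 := by
    rw [Fin.sum_univ_three]; linarith [hsq 0, hsq 1, hsq 2]
  simp only [Pi.zero_apply, sub_zero] at h1 h2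
  have h00 : ((0, 0) : SpTime) = 0 := rfl
  rw [h00] at h2
  have hz0 : ((z.1, z.2) : SpTime) = z := rfl
  rw [hz0] at h1
  have e1 := mul_le_mul_of_nonneg_left hz.le hK.le
  have e2 := mul_le_mul_of_nonneg_left hsum hK.le
  rw [abs_le] at *
  constructor <;> nlinarith
end

lemma mem_pball_iff {x w : SpTime} {L : ℝ} (hL : 0 < L) :
    w ∈ pball x L ↔ |w.1 - x.1| < L ^ 2 ∧ ∀ i, |w.2 i - x.2 i| < L := by
  rw [pball, Set.mem_ofPred_eq, pd, max_lt_iff, Real.sqrt_lt' hL, pi_norm_lt_iff hL, abs_sub_comm]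
  simp only [Pi.sub_apply, Real.norm_eq_abs, abs_sub_comm]

lemma isOpen_pball (x : SpTime) (L : ℝ) : IsOpen (pball x L) :=
  isOpen_lt (by unfold pd; fun_prop) continuous_const

/-- Smooth functions satisfy `HasHeatAt` with value `heatOp`. -/
lemma hasHeatAt_heatOp {U : SpTime → ℝ} {O : Set SpTime} (hO : IsOpen O)
    (hU : ContDiffOn ℝ (⊤ : ℕ∞) U O) {z : SpTime} (hz : z ∈ O) :
    HasHeatAt U (heatOp U z) z := by
  have hUz : ContDiffAt ℝ (⊤ : ℕ∞) U z := hU.contDiffAt (hO.mem_nhds hz)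
  have ht : ContDiffAt ℝ (⊤ : ℕ∞) (fun s => U (s, z.2)) z.1 :=
    ContDiffAt.comp (g := U) z.1 hUz (contDiffAt_id.prodMk contDiffAt_const)
  have hx : ∀ i, ContDiffAt ℝ (⊤ : ℕ∞) (fun s => U (z.1, Function.update z.2 i s)) (z.2 i) := by
    intro i
    refine ContDiffAt.comp (g := U) (z.2 i) (by simpa using hUz)
      (contDiffAt_const.prodMk (contDiff_update _ z.2 i).contDiffAt)
  have hX : ∀ i, (fun s => pderivX U i (z.1, Function.update z.2 i s)) =
      deriv fun s => U (z.1, Function.update z.2 i s) := fun i => by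
    ext s; simp [pderivX]
  refine ⟨hUz.continuousAt, pderivT U z, fun i s => pderivX U i (z.1, Function.update z.2 i s),
    fun i => pderivXX U i z, ?_, fun i => ?_, fun i => ?_, rfl⟩
  · exact (ht.differentiableAt (by simp)).hasDerivAt
  · have h1 : ContDiffAt ℝ 1 (fun s => U (z.1, Function.update z.2 i s)) (z.2 i) :=
      (hx i).of_le (by exact_mod_cast le_top)
    filter_upwards [h1.eventually (by simp)] with s hs
    rw [show pderivX U i (z.1, Function.update z.2 i s) = _ from congrFun (hX i) s]
    exact (hs.differentiableAt (by simp)).hasDerivAt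
  · have h1 : ContDiffAt ℝ 1 (deriv fun s => U (z.1, Function.update z.2 i s)) (z.2 i) :=
      ((hx i).fderiv_right (m := 1)
        (WithTop.coe_le_coe.2 (le_top : (1 + 1 : ℕ∞) ≤ ⊤))).clm_apply contDiffAt_const
    simp only [pderivXX, hX]
    exact (h1.differentiableAt (by simp)).hasDerivAt

/-- Caccioppoli-type excess-decay estimate for the heat operator. -/
theorem stmt_13 : ∃ c : ℝ, 0 < c ∧
    ∀ (U : SpTime → ℝ) (x : SpTime) (L R g K : ℝ),
      0 < L → 0 < R → R ≤ L / 2 → 0 ≤ g → 0 ≤ K →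
      ContDiffOn ℝ (⊤ : ℕ∞) U (pball x L) →
      (∀ z ∈ pball x L, |heatOp U z| ≤ g) →
      (∃ C₀ : Fin 3 → ℝ, ∃ c₀ : ℝ, ∀ z ∈ pball x L,
        |U z - (∑ i, C₀ i * (z.2 i - x.2 i) + c₀)| ≤ K) →
      ∃ C₁ : Fin 3 → ℝ, ∃ c₁ : ℝ, ∀ z ∈ pball x R,
        |U z - (∑ i, C₁ i * (z.2 i - x.2 i) + c₁)|
          ≤ c * (R ^ 2 / L ^ 2 * K + L ^ 2 * g) := by
  refine ⟨400000, by norm_num, ?_⟩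
  rintro U x L R g K hL hR hRL hg hK hU hheat ⟨C₀, c₀, hbd⟩
  obtain rfl | hK := hK.eq_or_lt
  · refine ⟨C₀, c₀, fun z hz => (hbd z ?_).trans (by positivity)⟩
    exact lt_of_lt_of_le (show pd x z < R from hz) (by linarith)
  set S : SpTime → SpTime := affMap (L ^ 2) x.1 (fun _ => L) x.2 with hS
  have hmem : ∀ z : SpTime, |z.1| < 1 → (∀ i, |z.2 i| < 1) → S z ∈ pball x L := by
    intro z h1 h2
    rw [mem_pball_iff hL]
    simp only [hS, affMap, add_sub_cancel_right, abs_mul, abs_of_pos hL, abs_of_pos (pow_pos hL 2)]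
    exact ⟨mul_lt_of_lt_one_right (by positivity) h1, fun i => mul_lt_of_lt_one_right hL (h2 i)⟩
  set V : SpTime → ℝ := fun z => U (S z) - (0 * (z.1 - 0) +
    ∑ i, (C₀ i * L * (z.2 i - (0 : Fin 3 → ℝ) i) + 0 * (z.2 i - (0 : Fin 3 → ℝ) i) ^ 2) + c₀) with hVdef
  have hV : HeatBounded V K (L ^ 2 * g) := by
    intro z h1 h2
    have hz := hmem z h1 h2
    refine ⟨?_, _, ?_, ((hasHeatAt_heatOp (isOpen_pball x L) hU hz).comp_affMap
      (fun _ => rfl)).sub (hasHeatAt_quadratic 0 0 c₀ _ 0 0 z)⟩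
    · simpa [hVdef, hS, affMap, mul_assoc] using hbd _ hz
    · simpa [abs_mul] using mul_le_mul_of_nonneg_left (hheat _ hz) (sq_nonneg L)
  obtain ⟨p, k, hpk⟩ := hV.exists_affine hK (by positivity) (R := R / L)
    (by rw [div_le_iff₀ hL]; linarith)
  refine ⟨fun i => C₀ i + p i / L, c₀ + k, fun z hz => ?_⟩
  obtain ⟨h1, h2⟩ := (mem_pball_iff hR).1 hz
  have := hpk ((z.1 - x.1) / L ^ 2, fun i => (z.2 i - x.2 i) / L)
    (by rw [abs_div, abs_of_pos (pow_pos hL 2), div_pow]; gcongr)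
    (fun i => by simp only [abs_div, abs_of_pos hL]; gcongr; exact h2 i)
  have hSz : S ((z.1 - x.1) / L ^ 2, fun i => (z.2 i - x.2 i) / L) = z := by
    refine Prod.ext ?_ (funext fun i => ?_) <;> simp only [hS, affMap] <;> field_simp <;> ring
  rw [div_pow] at this
  refine le_of_eq_of_le (congrArg _ ?_) this
  simp only [hVdef, hSz, Fin.sum_univ_three, Pi.zero_apply]
  field_simp
  ring
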